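/- arXiv:2501.08950 — 2 statements merged into one kernel-verified Lean document; each statement's English description precedes it below -/
import Mathlib

section
/- Let M = (S, A, T, R) be an MDP with finite value and let (M_n) with M_n = (S, A, T_n, R) be a sequence of MDPs over the same states, actions and rewards such that T_n converges pointwise to T and, for all n, s, a, s', T(s,a,s') = 0 implies T_n(s,a,s') = 0, and Σ_{s'} T_n(s,a,s') = Σ_{s'} T(s,a,s') for all s, a. Let f_n be the Bellman operator of M_n and f that of M, let ((α_n),(β_n)) be a regular Mann scheme, and let v_0 ∈ ℝ≥0^S be arbitrary. Then the dampened Mann iteration v_{n+1} = (1−β_n)·(α_n·v_n + (1−α_n)·f_n(v_n)) converges to the least fixpoint μf of f. -/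
open Filter Set Topology

/-- A Markov decision process with state space `S` and action space `A`:
transition probabilities `T s a s' ∈ [0,1]` with `Σ_{s'} T s a s' ∈ {0,1}` and
non-negative rewards `R`. -/
structure MDP (S A : Type) [Fintype S] [Fintype A] where
  T : S → A → S → ℝ
  R : S → A → S → ℝ
  T_nonneg : ∀ s a s', 0 ≤ T s a s'
  T_le_one : ∀ s a s', T s a s' ≤ 1
  T_sum : ∀ s a, (∑ s', T s a s') = 0 ∨ (∑ s', T s a s') = 1
  R_nonneg : ∀ s a s', 0 ≤ R s a s'

variable {S A : Type} [Fintype S] [Fintype A]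

/-- Action `a` is enabled in state `s`. -/
def MDP.enabled (M : MDP S A) (s : S) (a : A) : Prop :=
  (∑ s', M.T s a s') = 1

/-- The state-value Bellman operator
`f_M(v)(s) = max_{a ∈ A(s)} Σ_{s'} T(s,a,s') (R(s,a,s') + v(s'))`,
with the maximum over the empty set taken to be `0`. -/
noncomputable def MDP.bellman (M : MDP S A) (v : S → ℝ) : S → ℝ :=
  fun s => sSup (insert 0
    {x : ℝ | ∃ a, M.enabled s a ∧ x = ∑ s', M.T s a s' * (M.R s a s' + v s')})

/-- One step inside a candidate end-component: from `t` (in `S'`) one can move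
to `t'` with positive probability using an action from `A' t`. -/
def MDP.ecStep (M : MDP S A) (S' : Set S) (A' : S → Set A) (t t' : S) : Prop :=
  t ∈ S' ∧ ∃ a ∈ A' t, 0 < M.T t a t'

/-- `(S', A')` is an end-component of `M`. -/
def MDP.IsEndComponent (M : MDP S A) (S' : Set S) (A' : S → Set A) : Prop :=
  S'.Nonempty ∧
  (∀ s ∈ S', (A' s).Nonempty ∧ ∀ a ∈ A' s, M.enabled s a) ∧
  (∀ s ∉ S', A' s = ∅) ∧
  (∀ s ∈ S', ∀ a ∈ A' s, ∀ s', 0 < M.T s a s' → s' ∈ S') ∧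
  (∀ s ∈ S', ∀ s' ∈ S', Relation.ReflTransGen (M.ecStep S' A') s s')

/-- `(S', A')` is a maximal end-component of `M` (no strictly larger
end-component under pointwise inclusion exists). -/
def MDP.IsMaximalEC (M : MDP S A) (S' : Set S) (A' : S → Set A) : Prop :=
  M.IsEndComponent S' A' ∧
  ∀ S'' A'', M.IsEndComponent S'' A'' → S' ⊆ S'' → (∀ s, A' s ⊆ A'' s) →
    S'' = S' ∧ ∀ s, A'' s = A' s

/-- The dampened Mann iteration:
`x₀ = x0`, `x_{n+1} = (1 - β n) • (α n • x n + (1 - α n) • f n (x n))`. -/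
noncomputable def mannSeq {E : Type*} [AddCommGroup E] [Module ℝ E]
    (α β : ℕ → ℝ) (f : ℕ → E → E) (x0 : E) : ℕ → E
  | 0 => x0
  | n + 1 => (1 - β n) • (α n • mannSeq α β f x0 n + (1 - α n) • f n (mannSeq α β f x0 n))

/-- An exact Mann scheme: a pair of sequences in `[0,1)` with `β n → 0` and
`Σ β n = ∞` such that, for every dimension `d`, every closed convex set
`X ⊆ ℝ^d` of non-negative vectors containing `0`, every monotone non-expansive
`g : X → X` with at least one fixpoint and every starting point in `X`, the
dampened Mann iteration with the constant function sequence `g` converges to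
the least fixpoint of `g`. -/
def ExactScheme (α β : ℕ → ℝ) : Prop :=
  (∀ n, α n ∈ Set.Ico (0 : ℝ) 1) ∧ (∀ n, β n ∈ Set.Ico (0 : ℝ) 1) ∧
  Tendsto β atTop (nhds 0) ∧ ¬ Summable β ∧
  ∀ (d : ℕ) (X : Set (Fin d → ℝ)), IsClosed X → Convex ℝ X →
    (∀ x ∈ X, ∀ i, 0 ≤ x i) → (0 : Fin d → ℝ) ∈ X →
    ∀ g : (Fin d → ℝ) → (Fin d → ℝ), Set.MapsTo g X X →
      (∀ x ∈ X, ∀ y ∈ X, x ≤ y → g x ≤ g y) → LipschitzOnWith 1 g X →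
      (∃ x ∈ X, g x = x) →
      ∀ μ, IsLeast {x | x ∈ X ∧ g x = x} μ →
        ∀ x0 ∈ X, Tendsto (mannSeq α β (fun _ => g) x0) atTop (nhds μ)

/-- A regular Mann scheme: an exact Mann scheme that, in the approximated
setting, converges to the unique fixpoint of a power contraction `g` whenever
the approximations `gn` are monotone, non-expansive and converge pointwise to
`g`, and the generated iteration sequence is bounded. -/
def RegularScheme (α β : ℕ → ℝ) : Prop :=
  ExactScheme α β ∧
  ∀ (d : ℕ) (X : Set (Fin d → ℝ)), IsClosed X → Convex ℝ X →
    (∀ x ∈ X, ∀ i, 0 ≤ x i) → (0 : Fin d → ℝ) ∈ X →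
    ∀ (g : (Fin d → ℝ) → (Fin d → ℝ)) (gn : ℕ → (Fin d → ℝ) → (Fin d → ℝ)),
      Set.MapsTo g X X → (∀ n, Set.MapsTo (gn n) X X) →
      (∀ n, ∀ x ∈ X, ∀ y ∈ X, x ≤ y → gn n x ≤ gn n y) →
      (∀ n, LipschitzOnWith 1 (gn n) X) →
      (∀ x ∈ X, Tendsto (fun n => gn n x) atTop (nhds (g x))) →
      (∃ m, 1 ≤ m ∧ ∃ q : NNReal, q < 1 ∧ LipschitzOnWith q (g^[m]) X) →
      ∀ x0 ∈ X, (∃ C : ℝ, ∀ n, ‖mannSeq α β gn x0 n‖ ≤ C) →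
        ∀ xstar ∈ X, g xstar = xstar →
          Tendsto (mannSeq α β gn x0) atTop (nhds xstar)

/-- The value of taking action `a` in state `s` and continuing with value `v`. -/
noncomputable def MDP.actionValue (M : MDP S A) (v : S → ℝ) (s : S) (a : A) : ℝ :=
  ∑ s', M.T s a s' * (M.R s a s' + v s')

lemma MDP.bellman_le (M : MDP S A) {v : S → ℝ} {s : S} {b : ℝ} (hb : 0 ≤ b)
    (h : ∀ a, M.enabled s a → M.actionValue v s a ≤ b) : M.bellman v s ≤ b := by
  refine csSup_le (insert_nonempty _ _) ?_
  rintro x (rfl | ⟨a, ha, rfl⟩)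
  · exact hb
  · exact h a ha

lemma MDP.bellman_bddAbove (M : MDP S A) (v : S → ℝ) (s : S) :
    BddAbove (insert 0
      {x : ℝ | ∃ a, M.enabled s a ∧ x = ∑ s', M.T s a s' * (M.R s a s' + v s')}) := by
  refine Set.Finite.bddAbove (Set.Finite.insert _ ?_)
  refine (Set.finite_range (M.actionValue v s)).subset ?_
  rintro x ⟨a, -, rfl⟩
  exact ⟨a, rfl⟩

lemma MDP.actionValue_le_bellman (M : MDP S A) (v : S → ℝ) {s : S} {a : A}
    (ha : M.enabled s a) : M.actionValue v s a ≤ M.bellman v s :=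
  le_csSup (M.bellman_bddAbove v s) (mem_insert_of_mem _ ⟨a, ha, rfl⟩)

lemma MDP.bellman_nonneg (M : MDP S A) (v : S → ℝ) (s : S) : 0 ≤ M.bellman v s :=
  le_csSup (M.bellman_bddAbove v s) (mem_insert _ _)

lemma MDP.bellman_le_add {M M' : MDP S A} {u v : S → ℝ} {s : S} {K : ℝ} (hK : 0 ≤ K)
    (h : ∀ a, M'.enabled s a → M.enabled s a ∧ M'.actionValue u s a ≤ M.actionValue v s a + K) :
    M'.bellman u s ≤ M.bellman v s + K :=
  M'.bellman_le (add_nonneg (M.bellman_nonneg v s) hK) fun a ha =>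
    (h a ha).2.trans (add_le_add_left (M.actionValue_le_bellman v (h a ha).1) K)

lemma MDP.bellman_le_add_of_le_add (M : MDP S A) {u v : S → ℝ} {K : ℝ} (hK : 0 ≤ K)
    (h : ∀ s, u s ≤ v s + K) (s : S) : M.bellman u s ≤ M.bellman v s + K := by
  refine MDP.bellman_le_add hK fun a ha => ⟨ha, ?_⟩
  have h1 : M.actionValue u s a ≤ ∑ s', M.T s a s' * (M.R s a s' + (v s' + K)) :=
    Finset.sum_le_sum fun s' _ => mul_le_mul_of_nonneg_left
      (add_le_add_right (h s') _) (M.T_nonneg s a s')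
  have h2 : ∑ s', M.T s a s' * (M.R s a s' + (v s' + K)) = M.actionValue v s a + K := by
    have h3 : K = ∑ s', M.T s a s' * K := by
      rw [← Finset.sum_mul, show ∑ s', M.T s a s' = 1 from ha, one_mul]
    conv_rhs => rw [h3]
    rw [MDP.actionValue, ← Finset.sum_add_distrib]
    exact Finset.sum_congr rfl fun s' _ => by ring
  exact h1.trans h2.le

lemma MDP.bellman_mono (M : MDP S A) : Monotone M.bellman := fun u v h s => by
  simpa using M.bellman_le_add_of_le_add (u := u) (v := v) le_rfl (fun s => by simpa using h s) s

lemma MDP.dist_bellman_le (M : MDP S A) (u v : S → ℝ) :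
    dist (M.bellman u) (M.bellman v) ≤ dist u v := by
  refine (dist_pi_le_iff dist_nonneg).2 fun s => ?_
  have h : ∀ s, |u s - v s| ≤ dist u v := fun s => by
    simpa [Real.dist_eq] using dist_le_pi_dist u v s
  rw [Real.dist_eq, abs_sub_le_iff]
  constructor
  · have := M.bellman_le_add_of_le_add (u := u) (v := v) dist_nonneg
      (fun s => by linarith [(abs_le.1 (h s)).2]) s
    linarith
  · have := M.bellman_le_add_of_le_add (u := v) (v := u) dist_nonneg
      (fun s => by linarith [(abs_le.1 (h s)).1]) s
    linarith

lemma MDP.tendsto_bellman {M : MDP S A} {Mn : ℕ → MDP S A}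
    (hR : ∀ n, (Mn n).R = M.R)
    (hTconv : ∀ s a s', Tendsto (fun n => (Mn n).T s a s') atTop (nhds (M.T s a s')))
    (hsum : ∀ n s a, (∑ s', (Mn n).T s a s') = ∑ s', M.T s a s') (v : S → ℝ) :
    Tendsto (fun n => (Mn n).bellman v) atTop (nhds (M.bellman v)) := by
  refine tendsto_pi_nhds.2 fun s => ?_
  have hQ : ∀ a, Tendsto (fun n => (Mn n).actionValue v s a) atTop
      (nhds (M.actionValue v s a)) := fun a => by
    simp only [MDP.actionValue, hR]
    exact tendsto_finsetSum _ fun s' _ => (hTconv s a s').mul_const _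
  have hen : ∀ n a, (Mn n).enabled s a ↔ M.enabled s a := fun n a => by
    simp only [MDP.enabled, hsum]
  refine Metric.tendsto_nhds.2 fun ε hε => ?_
  have hev : ∀ᶠ n in atTop, ∀ a, dist ((Mn n).actionValue v s a) (M.actionValue v s a) < ε / 2 :=
    eventually_all.2 fun a => Metric.tendsto_nhds.1 (hQ a) _ (half_pos hε)
  filter_upwards [hev] with n hn
  simp only [Real.dist_eq, abs_lt] at hn
  refine lt_of_le_of_lt ?_ (half_lt_self hε)
  rw [Real.dist_eq, abs_sub_le_iff]
  constructor
  · have := MDP.bellman_le_add (M := M) (M' := Mn n) (u := v) (v := v) (s := s) (half_pos hε).le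
      fun a ha => ⟨(hen n a).1 ha, by linarith [(hn a).2]⟩
    linarith
  · have := MDP.bellman_le_add (M := Mn n) (M' := M) (u := v) (v := v) (s := s) (half_pos hε).le
      fun a ha => ⟨(hen n a).2 ha, by linarith [(hn a).1]⟩
    linarith

/-- Strict concavity of the square root turns a fixpoint `v` of the Bellman operator into a
weight `√(1 + v)` that strictly decreases in expectation under an action, unless that action
yields no reward and does not change the value. -/
lemma MDP.sum_sqrt_lt_or (M : MDP S A) {v : S → ℝ} (hv : ∀ s, 0 ≤ v s)
    (hfix : M.bellman v = v) {s : S} {a : A} (ha : M.enabled s a) :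
    (∑ s', M.T s a s' * √(1 + v s') < √(1 + v s)) ∨
      ∀ s', M.T s a s' = 0 ∨ (M.R s a s' = 0 ∧ v s' = v s) := by
  have hQ : M.actionValue v s a ≤ v s := by
    simpa [hfix] using M.actionValue_le_bellman v ha
  have hsq : ∀ t, √(1 + v t) * √(1 + v t) = 1 + v t := fun t =>
    Real.mul_self_sqrt (by linarith [hv t])
  have hpos : 0 < √(1 + v s) := Real.sqrt_pos.2 (by linarith [hv s])
  have hnn : ∀ s' ∈ Finset.univ,
      0 ≤ M.T s a s' * (M.R s a s' + (√(1 + v s) - √(1 + v s')) ^ 2) := fun s' _ =>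
    mul_nonneg (M.T_nonneg s a s') (add_nonneg (M.R_nonneg s a s') (sq_nonneg _))
  have hid : ∑ s', M.T s a s' * (M.R s a s' + (√(1 + v s) - √(1 + v s')) ^ 2) =
      M.actionValue v s a + (2 + v s)
        - 2 * √(1 + v s) * ∑ s', M.T s a s' * √(1 + v s') := by
    have h1 : 2 + v s = ∑ s', M.T s a s' * (2 + v s) := by
      rw [← Finset.sum_mul, show ∑ s', M.T s a s' = 1 from ha, one_mul]
    rw [h1, MDP.actionValue, Finset.mul_sum, ← Finset.sum_add_distrib, ← Finset.sum_sub_distrib]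
    refine Finset.sum_congr rfl fun s' _ => ?_
    linear_combination M.T s a s' * (hsq s + hsq s')
  rcases (Finset.sum_nonneg hnn).lt_or_eq with hD | hD
  · left
    nlinarith [hsq s]
  · right
    intro s'
    have h0 := (Finset.sum_eq_zero_iff_of_nonneg hnn).1 hD.symm s' (Finset.mem_univ _)
    refine (mul_eq_zero.1 h0).imp id fun h => ?_
    have hr := M.R_nonneg s a s'
    have hs := sq_nonneg (√(1 + v s) - √(1 + v s'))
    refine ⟨by linarith, ?_⟩
    have h2 : √(1 + v s) = √(1 + v s') :=
      sub_eq_zero.1 (pow_eq_zero_iff two_ne_zero |>.1 (by linarith))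
    have h3 := hsq s
    rw [h2, hsq s'] at h3
    linarith

/-- Above a fixpoint of the limit operator, the approximated operators eventually admit a cone
of pre-fixpoints. -/
lemma MDP.eventually_bellman_le {M : MDP S A} {Mn : ℕ → MDP S A}
    (hR : ∀ n, (Mn n).R = M.R)
    (hTconv : ∀ s a s', Tendsto (fun n => (Mn n).T s a s') atTop (nhds (M.T s a s')))
    (hzero : ∀ n s a s', M.T s a s' = 0 → (Mn n).T s a s' = 0)
    (hsum : ∀ n s a, (∑ s', (Mn n).T s a s') = ∑ s', M.T s a s')
    {v : S → ℝ} (hv : ∀ s, 0 ≤ v s) (hfix : M.bellman v = v) {η : ℝ} (hη : 0 < η) :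
    ∀ᶠ n in atTop, ∀ c, η ≤ c → ∀ s,
      (Mn n).bellman (fun t => v t + c * √(1 + v t)) s ≤ v s + c * √(1 + v s) := by
  have key : ∀ s a, ∀ᶠ n in atTop, ∀ c, η ≤ c → (Mn n).enabled s a →
      (Mn n).actionValue (fun t => v t + c * √(1 + v t)) s a ≤ v s + c * √(1 + v s) := by
    intro s a
    by_cases ha : M.enabled s a
    swap
    · refine Eventually.of_forall fun n c _ h => absurd ?_ ha
      simpa only [MDP.enabled, hsum] using h
    rcases M.sum_sqrt_lt_or hv hfix ha with hlt | hconst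
    · have hQ : M.actionValue v s a ≤ v s := by
        simpa [hfix] using M.actionValue_le_bellman v ha
      have hW : Tendsto (fun n => ∑ s', (Mn n).T s a s' * √(1 + v s')) atTop
          (nhds (∑ s', M.T s a s' * √(1 + v s'))) :=
        tendsto_finsetSum _ fun s' _ => (hTconv s a s').mul_const _
      have hA : Tendsto (fun n => (Mn n).actionValue v s a) atTop
          (nhds (M.actionValue v s a)) := by
        simp only [MDP.actionValue, hR]
        exact tendsto_finsetSum _ fun s' _ => (hTconv s a s').mul_const _
      have hlt2 : M.actionValue v s a + η * ∑ s', M.T s a s' * √(1 + v s') <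
          v s + η * √(1 + v s) := by nlinarith
      filter_upwards [hW.eventually_lt_const hlt,
        (hA.add (hW.const_mul η)).eventually_lt_const hlt2] with n h1 h2 c hc _
      have h3 : (Mn n).actionValue (fun t => v t + c * √(1 + v t)) s a =
          (Mn n).actionValue v s a + c * ∑ s', (Mn n).T s a s' * √(1 + v s') := by
        simp only [MDP.actionValue]
        rw [Finset.mul_sum, ← Finset.sum_add_distrib]
        exact Finset.sum_congr rfl fun s' _ => by ring
      rw [h3]
      nlinarith
    · refine Eventually.of_forall fun n c _ hen => ?_
      have h3 : (Mn n).actionValue (fun t => v t + c * √(1 + v t)) s a =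
          ∑ s', (Mn n).T s a s' * (v s + c * √(1 + v s)) := by
        refine Finset.sum_congr rfl fun s' _ => ?_
        rcases hconst s' with h | ⟨h, h'⟩
        · rw [hzero n s a s' h, zero_mul, zero_mul]
        · simp only [hR, h, h', zero_add]
      rw [h3, ← Finset.sum_mul, show ∑ s', (Mn n).T s a s' = 1 from hen, one_mul]
  filter_upwards [eventually_all.2 fun s => eventually_all.2 fun a => key s a] with n hn c hc s
  exact (Mn n).bellman_le
    (add_nonneg (hv s) (mul_nonneg (hη.le.trans hc) (Real.sqrt_nonneg _)))
    fun a ha => hn s a c hc ha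

lemma tendsto_prod_one_sub_zero {β : ℕ → ℝ} (hβ : ∀ n, β n ∈ Set.Ico (0 : ℝ) 1)
    (hs : ¬ Summable β) :
    Tendsto (fun k => ∏ i ∈ Finset.range k, (1 - β i)) atTop (nhds 0) := by
  have h1 := (not_summable_iff_tendsto_nat_atTop_of_nonneg fun n => (hβ n).1).1 hs
  refine squeeze_zero (fun k => Finset.prod_nonneg fun i _ => by linarith [(hβ i).2])
    (fun k => ?_) (Real.tendsto_exp_neg_atTop_nhds_zero.comp h1)
  rw [Function.comp_apply, ← Finset.sum_neg_distrib, Real.exp_sum]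
  exact Finset.prod_le_prod (fun i _ => by linarith [(hβ i).2])
    fun i _ => by linarith [Real.add_one_le_exp (-β i)]

lemma mannSeq_nonneg {ι : Type*} {α β : ℕ → ℝ} (hα : ∀ n, α n ∈ Set.Ico (0 : ℝ) 1)
    (hβ : ∀ n, β n ∈ Set.Ico (0 : ℝ) 1) {f : ℕ → (ι → ℝ) → ι → ℝ}
    (hf : ∀ n x s, 0 ≤ f n x s) {x0 : ι → ℝ} (hx0 : ∀ s, 0 ≤ x0 s) (n : ℕ) (s : ι) :
    0 ≤ mannSeq α β f x0 n s := by
  induction n with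
  | zero => exact hx0 s
  | succ n ih =>
    have h1 := (hα n).1
    have h2 : 0 ≤ 1 - α n := by linarith [(hα n).2]
    have h3 : 0 ≤ 1 - β n := by linarith [(hβ n).2]
    have h4 := hf n (mannSeq α β f x0 n) s
    simp only [mannSeq, Pi.smul_apply, Pi.add_apply, smul_eq_mul]
    positivity

lemma mannSeq_le_mannSeq {ι : Type*} {α β : ℕ → ℝ} (hα : ∀ n, α n ∈ Set.Ico (0 : ℝ) 1)
    (hβ : ∀ n, β n ∈ Set.Ico (0 : ℝ) 1) {f g : ℕ → (ι → ℝ) → ι → ℝ}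
    (hfg : ∀ n x, f n x ≤ g n x) (hg : ∀ n, Monotone (g n)) (x0 : ι → ℝ) (n : ℕ) :
    mannSeq α β f x0 n ≤ mannSeq α β g x0 n := by
  induction n with
  | zero => exact le_rfl
  | succ n ih =>
    have h1 := (hα n).1
    have h2 : 0 ≤ 1 - α n := by linarith [(hα n).2]
    have h3 : 0 ≤ 1 - β n := by linarith [(hβ n).2]
    intro s
    have h4 := ((hfg n _).trans (hg n ih)) s
    have h5 := ih s
    simp only [mannSeq, Pi.smul_apply, Pi.add_apply, smul_eq_mul]
    gcongr

lemma mannSeq_linearEquiv {E F : Type*} [AddCommGroup E] [Module ℝ E] [AddCommGroup F]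
    [Module ℝ F] (L : E ≃ₗ[ℝ] F) (α β : ℕ → ℝ) (f : ℕ → E → E) (x0 : E) (n : ℕ) :
    mannSeq α β (fun n x => L (f n (L.symm x))) (L x0) n = L (mannSeq α β f x0 n) := by
  induction n with
  | zero => rfl
  | succ n ih => simp [mannSeq, ih]

/-- Any fixpoint of the limit operator is an asymptotic upper bound of the iteration. -/
lemma MDP.eventually_mannSeq_le {M : MDP S A} {Mn : ℕ → MDP S A}
    (hR : ∀ n, (Mn n).R = M.R)
    (hTconv : ∀ s a s', Tendsto (fun n => (Mn n).T s a s') atTop (nhds (M.T s a s')))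
    (hzero : ∀ n s a s', M.T s a s' = 0 → (Mn n).T s a s' = 0)
    (hsum : ∀ n s a, (∑ s', (Mn n).T s a s') = ∑ s', M.T s a s')
    {α β : ℕ → ℝ} (hα : ∀ n, α n ∈ Set.Ico (0 : ℝ) 1)
    (hβ : ∀ n, β n ∈ Set.Ico (0 : ℝ) 1) (hsβ : ¬ Summable β)
    {v0 : S → ℝ} (hv0 : ∀ s, 0 ≤ v0 s)
    {v : S → ℝ} (hv : ∀ s, 0 ≤ v s) (hfix : M.bellman v = v) {ε : ℝ} (hε : 0 < ε) :
    ∀ᶠ n in atTop, ∀ s, mannSeq α β (fun n => (Mn n).bellman) v0 n s ≤ v s + ε := by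
  set x := mannSeq α β (fun n => (Mn n).bellman) v0 with hx
  have hx0 : ∀ n s, 0 ≤ x n s :=
    mannSeq_nonneg hα hβ (fun n u s => (Mn n).bellman_nonneg u s) hv0
  set W : ℝ := ∑ s, √(1 + v s) with hW
  have hW0 : 0 ≤ W := Finset.sum_nonneg fun s _ => Real.sqrt_nonneg _
  have hwW : ∀ s, √(1 + v s) ≤ W := fun s =>
    Finset.single_le_sum (f := fun s => √(1 + v s)) (fun s _ => Real.sqrt_nonneg _)
      (Finset.mem_univ s)
  have hw1 : ∀ s, 1 ≤ √(1 + v s) := fun s => Real.one_le_sqrt.2 (by linarith [hv s])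
  set η : ℝ := ε / (W + 1) with hη
  have hη0 : 0 < η := by positivity
  have hηW : η * W ≤ ε := by
    rw [hη, div_mul_eq_mul_div, div_le_iff₀ (by positivity)]
    nlinarith
  obtain ⟨N, hN⟩ := eventually_atTop.1
    (MDP.eventually_bellman_le hR hTconv hzero hsum hv hfix hη0)
  set C : ℝ := ∑ s, x N s with hC
  have hC0 : 0 ≤ C := Finset.sum_nonneg fun s _ => hx0 N s
  set p : ℕ → ℝ := fun k => ∏ i ∈ Finset.range k, (1 - β (i + N)) with hp
  have hstep : ∀ k s, x (k + N) s ≤ v s + max η (C * p k) * √(1 + v s) := by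
    intro k
    induction k with
    | zero =>
      intro s
      have h1 : x N s ≤ C := Finset.single_le_sum (f := x N) (fun s _ => hx0 N s)
        (Finset.mem_univ s)
      have h2 : C ≤ max η (C * p 0) := by simp [hp]
      rw [zero_add]
      nlinarith [hv s, hw1 s]
    | succ k ih =>
      intro s
      set c := max η (C * p k) with hc
      have hηc : η ≤ c := le_max_left _ _
      have h1 : (Mn (k + N)).bellman (x (k + N)) s ≤ v s + c * √(1 + v s) :=
        ((Mn (k + N)).bellman_mono ih s).trans (hN (k + N) (by omega) c hηc s)
      have h2 := ih s
      have hα0 := (hα (k + N)).1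
      have hα1 : 0 ≤ 1 - α (k + N) := by linarith [(hα (k + N)).2]
      have hβ0 := (hβ (k + N)).1
      have hβ1 : 0 ≤ 1 - β (k + N) := by linarith [(hβ (k + N)).2]
      have h3 : (1 - β (k + N)) * c ≤ max η (C * p (k + 1)) := by
        rw [hc, mul_max_of_nonneg _ _ hβ1]
        refine max_le_max (by nlinarith) (le_of_eq ?_)
        simp only [hp, Finset.prod_range_succ]
        ring
      have h4 : α (k + N) * x (k + N) s + (1 - α (k + N)) * (Mn (k + N)).bellman (x (k + N)) s ≤
          v s + c * √(1 + v s) := by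
        nlinarith [mul_le_mul_of_nonneg_left h2 hα0, mul_le_mul_of_nonneg_left h1 hα1]
      have h5 : x (k + 1 + N) s = (1 - β (k + N)) *
          (α (k + N) * x (k + N) s + (1 - α (k + N)) * (Mn (k + N)).bellman (x (k + N)) s) := by
        rw [show k + 1 + N = k + N + 1 by omega]
        rfl
      rw [h5]
      calc _ ≤ (1 - β (k + N)) * (v s + c * √(1 + v s)) := mul_le_mul_of_nonneg_left h4 hβ1
        _ = v s - β (k + N) * v s + ((1 - β (k + N)) * c) * √(1 + v s) := by ring
        _ ≤ v s + max η (C * p (k + 1)) * √(1 + v s) :=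
          add_le_add (sub_le_self _ (mul_nonneg hβ0 (hv s)))
            (mul_le_mul_of_nonneg_right h3 (Real.sqrt_nonneg _))
  have hp0 : Tendsto p atTop (nhds 0) :=
    tendsto_prod_one_sub_zero (fun n => hβ (n + N)) fun h => hsβ ((summable_nat_add_iff N).1 h)
  have hCp : ∀ᶠ k in atTop, C * p k < η :=
    (by simpa using hp0.const_mul C : Tendsto (fun k => C * p k) atTop (nhds 0)).eventually_lt_const
      hη0
  obtain ⟨K, hK⟩ := eventually_atTop.1 hCp
  refine eventually_atTop.2 ⟨K + N, fun n hn s => ?_⟩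
  obtain ⟨k, rfl⟩ : ∃ k, n = k + N := ⟨n - N, by omega⟩
  have h1 := hstep k s
  rw [max_eq_left (hK k (by omega)).le] at h1
  nlinarith [mul_le_mul_of_nonneg_left (hwW s) hη0.le]

lemma MDP.exists_discounted_fixpoint (M : MDP S A) {l : NNReal} (hl : l < 1) :
    ∃ u : S → ℝ, (∀ s, 0 ≤ u s) ∧ (l : ℝ) • M.bellman u = u ∧
      ∀ v : S → ℝ, (l : ℝ) • M.bellman v ≤ v → u ≤ v := by
  have hlip : LipschitzWith l fun u : S → ℝ => (l : ℝ) • M.bellman u :=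
    LipschitzWith.of_dist_le_mul fun u v => by
      rw [dist_smul₀, Real.norm_of_nonneg l.coe_nonneg]
      exact mul_le_mul_of_nonneg_left (M.dist_bellman_le u v) l.2
  have hc : ContractingWith l fun u : S → ℝ => (l : ℝ) • M.bellman u := ⟨hl, hlip⟩
  have hfix := hc.fixedPoint_isFixedPt
  refine ⟨_, fun s => ?_, hfix, fun v hv => ?_⟩
  · rw [← hfix]
    exact mul_nonneg l.2 (M.bellman_nonneg _ s)
  · have hmono : Monotone fun u : S → ℝ => (l : ℝ) • M.bellman u := fun u v h =>
      smul_le_smul_of_nonneg_left (M.bellman_mono h) l.2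
    refine le_of_tendsto' (hc.tendsto_iterate_fixedPoint v) fun n => ?_
    exact hmono.antitone_iterate_of_map_le hv (Nat.zero_le n)

lemma MDP.exists_least_fixpoint (M : MDP S A)
    (hfin : ∃ v : S → ℝ, (∀ s, 0 ≤ v s) ∧ M.bellman v = v) :
    ∃ (μ : S → ℝ) (l : ℕ → NNReal) (u : ℕ → S → ℝ),
      IsLeast {v : S → ℝ | (∀ s, 0 ≤ v s) ∧ M.bellman v = v} μ ∧ (∀ k, l k < 1) ∧
      (∀ k s, 0 ≤ u k s) ∧ (∀ k, (l k : ℝ) • M.bellman (u k) = u k) ∧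
      Tendsto u atTop (nhds μ) := by
  obtain ⟨b, hb⟩ := hfin
  set l : ℕ → NNReal := fun k => 1 - 1 / ((k : NNReal) + 1) with hl
  have hl1 : ∀ k, l k < 1 := fun k => tsub_lt_self one_pos (by positivity)
  have hlm : Monotone l := fun i j hij => by
    simp only [hl]
    gcongr
  have hlim : Tendsto (fun k => (l k : ℝ)) atTop (nhds 1) := by
    have h1 : ∀ k, (l k : ℝ) = 1 - 1 / ((k : ℝ) + 1) := fun k => by
      simp only [hl]
      rw [NNReal.coe_sub]
      · push_cast
        rfl
      · rw [div_le_iff₀ (by positivity)]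
        simp
    simp only [h1]
    simpa using tendsto_one_div_add_atTop_nhds_zero_nat.const_sub (1 : ℝ)
  choose u hu0 hufix hule using fun k => M.exists_discounted_fixpoint (hl1 k)
  have hle : ∀ k (v : S → ℝ), (∀ s, 0 ≤ v s) → M.bellman v = v → u k ≤ v := fun k v hv hf =>
    hule k v fun s => by
      rw [hf]
      exact mul_le_of_le_one_left (hv s) (NNReal.coe_le_one.2 (hl1 k).le)
  have hmono : Monotone u := fun i j hij => hule i _ fun s => by
    conv_rhs => rw [← hufix j]
    exact mul_le_mul_of_nonneg_right (NNReal.coe_le_coe.2 (hlm hij)) (M.bellman_nonneg _ s)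
  have htend : Tendsto u atTop (nhds fun s => ⨆ k, u k s) := tendsto_pi_nhds.2 fun s =>
    tendsto_atTop_ciSup (fun i j hij => hmono hij s)
      ⟨b s, by rintro _ ⟨k, rfl⟩; exact hle k b hb.1 hb.2 s⟩
  have hcont : Continuous M.bellman :=
    (LipschitzWith.of_dist_le_mul (K := 1) fun u v => by
      simpa using M.dist_bellman_le u v).continuous
  refine ⟨_, l, u, ⟨⟨fun s => ?_, ?_⟩, fun v hv => ?_⟩, hl1, hu0, hufix, htend⟩
  · exact ge_of_tendsto' (tendsto_pi_nhds.1 htend s) fun k => hu0 k s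
  · have h1 := hlim.smul ((hcont.tendsto _).comp htend)
    simp only [Function.comp_def, hufix, one_smul] at h1
    exact tendsto_nhds_unique h1 htend
  · exact le_of_tendsto' htend fun k => hle k v hv.1 hv.2

/-- Under a regular scheme, the iteration over discounted approximated operators converges to the
discounted value. -/
lemma MDP.tendsto_discounted_mannSeq {M : MDP S A} {Mn : ℕ → MDP S A}
    (hR : ∀ n, (Mn n).R = M.R)
    (hTconv : ∀ s a s', Tendsto (fun n => (Mn n).T s a s') atTop (nhds (M.T s a s')))
    (hsum : ∀ n s a, (∑ s', (Mn n).T s a s') = ∑ s', M.T s a s')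
    {α β : ℕ → ℝ} (hreg : RegularScheme α β) {v0 : S → ℝ} (hv0 : ∀ s, 0 ≤ v0 s)
    {l : NNReal} (hl : l < 1) {u : S → ℝ} (hu : ∀ s, 0 ≤ u s)
    (hfix : (l : ℝ) • M.bellman u = u)
    (hbdd : ∃ C, ∀ n s, mannSeq α β (fun n x => (l : ℝ) • (Mn n).bellman x) v0 n s ≤ C) :
    Tendsto (mannSeq α β (fun n x => (l : ℝ) • (Mn n).bellman x) v0) atTop (nhds u) := by
  set L : (S → ℝ) ≃ₗ[ℝ] (Fin (Fintype.card S) → ℝ) :=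
    LinearEquiv.funCongrLeft ℝ ℝ (Fintype.equivFin S).symm with hL
  have hLa : ∀ x i, L x i = x ((Fintype.equivFin S).symm i) := fun x i => rfl
  have hLd : ∀ x y, dist (L x) (L y) ≤ dist x y := fun x y =>
    (dist_pi_le_iff dist_nonneg).2 fun i => dist_le_pi_dist x y _
  have hLsd : ∀ x y, dist (L.symm x) (L.symm y) ≤ dist x y := fun x y =>
    (dist_pi_le_iff dist_nonneg).2 fun i => dist_le_pi_dist x y _
  have hLc : Continuous L := L.toLinearMap.continuous_of_finiteDimensional
  have hLsc : Continuous L.symm := L.symm.toLinearMap.continuous_of_finiteDimensional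
  have hlip : ∀ M : MDP S A, LipschitzWith l fun y => L ((l : ℝ) • M.bellman (L.symm y)) :=
    fun M => LipschitzWith.of_dist_le_mul fun x y => by
      refine (hLd _ _).trans ?_
      rw [dist_smul₀, Real.norm_of_nonneg l.coe_nonneg]
      exact mul_le_mul_of_nonneg_left ((M.dist_bellman_le _ _).trans (hLsd _ _)) l.2
  have hnn : ∀ (M : MDP S A) x s, 0 ≤ ((l : ℝ) • M.bellman x) s := fun M x s =>
    mul_nonneg l.2 (M.bellman_nonneg x s)
  have h0 : ∀ n s, 0 ≤ mannSeq α β (fun n x => (l : ℝ) • (Mn n).bellman x) v0 n s :=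
    mannSeq_nonneg hreg.1.1 hreg.1.2.1 (fun n x s => hnn (Mn n) x s) hv0
  obtain ⟨C, hC⟩ := hbdd
  have main := hreg.2 (Fintype.card S) (Set.Ici 0) isClosed_Ici (convex_Ici 0)
    (fun x hx i => hx i) (Set.mem_Ici.2 le_rfl)
    (fun y => L ((l : ℝ) • M.bellman (L.symm y)))
    (fun n y => L ((l : ℝ) • (Mn n).bellman (L.symm y)))
    (fun y _ i => hnn M _ _) (fun n y _ i => hnn (Mn n) _ _)
    (fun n x _ y _ hxy i => mul_le_mul_of_nonneg_left
      ((Mn n).bellman_mono (fun s => hxy _) _) l.2)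
    (fun n => ((hlip (Mn n)).weaken hl.le).lipschitzOnWith)
    (fun x _ => (hLc.tendsto _).comp
      ((MDP.tendsto_bellman hR hTconv hsum (L.symm x)).const_smul (l : ℝ)))
    ⟨1, le_rfl, l, hl, by simpa using (hlip M).lipschitzOnWith⟩
    (L v0) (fun i => hv0 _)
    ⟨max C 0, fun n => by
      rw [mannSeq_linearEquiv L α β (fun n x => (l : ℝ) • (Mn n).bellman x),
        pi_norm_le_iff_of_nonneg (le_max_right _ _)]
      intro i
      rw [hLa, Real.norm_of_nonneg (h0 n _)]
      exact (hC n _).trans (le_max_left _ _)⟩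
    (L u) (fun i => hu _) (by rw [L.symm_apply_apply, hfix])
  have := (hLsc.tendsto _).comp main
  simpa only [Function.comp_def,
    mannSeq_linearEquiv L α β (fun n x => (l : ℝ) • (Mn n).bellman x),
    L.symm_apply_apply] using this

/-- for an MDP `M` with finite value and sampled approximations
`Mn` as above and a regular Mann scheme, the dampened Mann iteration over the
approximated Bellman operators converges to the least fixpoint of the Bellman
operator of `M`, from every starting point. -/
theorem mdp_mann_iteration_converges (S A : Type) [Fintype S] [Fintype A]
    (M : MDP S A) (Mn : ℕ → MDP S A)
    (hR : ∀ n, (Mn n).R = M.R)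
    (hTconv : ∀ s a s', Tendsto (fun n => (Mn n).T s a s') atTop (nhds (M.T s a s')))
    (hzero : ∀ n s a s', M.T s a s' = 0 → (Mn n).T s a s' = 0)
    (hsum : ∀ n s a, (∑ s', (Mn n).T s a s') = ∑ s', M.T s a s')
    (hfin : ∃ v : S → ℝ, (∀ s, 0 ≤ v s) ∧ M.bellman v = v)
    (α β : ℕ → ℝ) (hreg : RegularScheme α β)
    (v0 : S → ℝ) (hv0 : ∀ s, 0 ≤ v0 s) :
    ∃ μ : S → ℝ, IsLeast {v : S → ℝ | (∀ s, 0 ≤ v s) ∧ M.bellman v = v} μ ∧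
      Tendsto (mannSeq α β (fun n => (Mn n).bellman) v0) atTop (nhds μ) := by
  obtain ⟨hα, hβ, -, hsβ, -⟩ := hreg.1
  obtain ⟨μ, l, u, hμ, hl, hu0, hufix, hu⟩ := M.exists_least_fixpoint hfin
  refine ⟨μ, hμ, tendsto_pi_nhds.2 fun s => ?_⟩
  have hup := fun {ε : ℝ} (hε : 0 < ε) => MDP.eventually_mannSeq_le hR hTconv hzero hsum hα hβ
    hsβ hv0 hμ.1.1 hμ.1.2 hε
  have hbdd : ∀ s, ∃ C, ∀ n, mannSeq α β (fun n => (Mn n).bellman) v0 n s ≤ C := fun s => by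
    have h1 : IsBoundedUnder (· ≤ ·) atTop
        fun n => mannSeq α β (fun n => (Mn n).bellman) v0 n s :=
      ⟨μ s + 1, eventually_map.2 ((hup one_pos).mono fun n hn => hn s)⟩
    obtain ⟨C, hC⟩ := h1.bddAbove_range
    exact ⟨C, fun n => hC ⟨n, rfl⟩⟩
  choose C hC using hbdd
  have hle : ∀ k n, mannSeq α β (fun n x => (l k : ℝ) • (Mn n).bellman x) v0 n ≤
      mannSeq α β (fun n => (Mn n).bellman) v0 n := fun k n =>
    mannSeq_le_mannSeq hα hβ
      (fun n x t => mul_le_of_le_one_left ((Mn n).bellman_nonneg x t)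
        (NNReal.coe_le_one.2 (hl k).le))
      (fun n => (Mn n).bellman_mono) v0 n
  have hlow : ∀ k, Tendsto (mannSeq α β (fun n x => (l k : ℝ) • (Mn n).bellman x) v0) atTop
      (nhds (u k)) := fun k => by
    obtain ⟨B, hB⟩ := (Set.finite_range C).bddAbove
    exact MDP.tendsto_discounted_mannSeq hR hTconv hsum hreg hv0 (hl k) (hu0 k) (hufix k)
      ⟨B, fun n t => (hle k n t).trans ((hC t n).trans (hB ⟨t, rfl⟩))⟩
  refine tendsto_order.2 ⟨fun b hb => ?_, fun b hb => ?_⟩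
  · obtain ⟨k, hk⟩ := ((tendsto_pi_nhds.1 hu s).eventually_const_lt hb).exists
    filter_upwards [(tendsto_pi_nhds.1 (hlow k) s).eventually_const_lt hk] with n hn
    exact hn.trans_le (hle k n s)
  · filter_upwards [hup (half_pos (sub_pos.2 hb))] with n hn
    linarith [hn s]
end

section
/- Let f : X → X be monotone and non-expansive with at least one fixpoint and let ((α_n),(β_n)) be an exact Mann scheme. Let (Ω, 𝒜, P) be a probability space and for each i ∈ ℕ let F_i : Ω → (X → X) be a random function such that F_i(ω) is monotone and non-expansive for every ω ∈ Ω. Let (γ_i) and (δ_i) be sequences of non-negative reals with Σ_i γ_i < ∞ and Σ_i δ_i < ∞, and suppose that for each i the set {ω ∈ Ω : sup_{x∈X} ‖F_i(ω)(x) − f(x)‖ ≥ γ_i} is measurable with probability at most δ_i. Then for P-almost every ω ∈ Ω, the dampened Mann iteration x_0(ω) = 0, x_{i+1}(ω) = (1−β_i)·(α_i·x_i(ω) + (1−α_i)·F_i(ω)(x_i(ω))) converges to the least fixpoint μf of f. -/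
open Filter Set Topology MeasureTheory

open Finset in
/-- A discrete Grönwall-type criterion: if `e (n + 1) ≤ (1 - b n) * e n + c n` eventually, where
`∑ b n = ∞` and `∑ c n < ∞`, then `e` tends to `0`. -/
lemma tendsto_zero_of_eventually_le_one_sub_mul_add {e b c : ℕ → ℝ} (he : ∀ n, 0 ≤ e n)
    (hb : ∀ n, b n ∈ Set.Ico (0 : ℝ) 1) (hbs : ¬ Summable b)
    (hc : ∀ n, 0 ≤ c n) (hcs : Summable c)
    (h : ∀ᶠ n in atTop, e (n + 1) ≤ (1 - b n) * e n + c n) :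
    Tendsto e atTop (𝓝 0) := by
  obtain ⟨N, hN⟩ := eventually_atTop.1 h
  rw [Metric.tendsto_atTop]
  intro ε hε
  obtain ⟨m, hm_tail, hmN⟩ := (((tendsto_sum_nat_add c).eventually_lt_const
    (half_pos hε)).and (eventually_ge_atTop N)).exists
  have hbound : ∀ k, e (k + m) ≤
      Real.exp (-∑ i ∈ range k, b (i + m)) * e m + ∑ i ∈ range k, c (i + m) := by
    intro k
    induction k with
    | zero => simp
    | succ k ih =>
      have hstep := hN (k + m) (by omega)
      obtain ⟨hb0, hb1⟩ := hb (k + m)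
      have hexp : 1 - b (k + m) ≤ Real.exp (-b (k + m)) := Real.one_sub_le_exp_neg _
      have hsum : 0 ≤ ∑ i ∈ range k, c (i + m) := sum_nonneg fun i _ => hc _
      have hP : 0 ≤ Real.exp (-∑ i ∈ range k, b (i + m)) * e m :=
        mul_nonneg (Real.exp_pos _).le (he m)
      rw [sum_range_succ, sum_range_succ, neg_add, Real.exp_add,
        show k + 1 + m = k + m + 1 by ring]
      have h1 := mul_le_mul_of_nonneg_left ih (sub_nonneg.2 hb1.le)
      have h2 := mul_le_mul_of_nonneg_right hexp hP
      nlinarith [mul_nonneg hb0 hsum]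
  have hdiv : Tendsto (fun k => ∑ i ∈ range k, b (i + m)) atTop atTop :=
    (not_summable_iff_tendsto_nat_atTop_of_nonneg fun i => (hb (i + m)).1).1
      fun hs => hbs ((summable_nat_add_iff m).1 hs)
  have hlim : Tendsto (fun k => Real.exp (-∑ i ∈ range k, b (i + m)) * e m) atTop (𝓝 0) := by
    simpa using (Real.tendsto_exp_neg_atTop_nhds_zero.comp hdiv).mul_const (e m)
  obtain ⟨K, hK⟩ := eventually_atTop.1 (hlim.eventually_lt_const (half_pos hε))
  refine ⟨K + m, fun n hn => ?_⟩
  obtain ⟨k, rfl⟩ : ∃ k, n = k + m := ⟨n - m, by omega⟩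
  have htail : ∑ i ∈ range k, c (i + m) ≤ ∑' i, c (i + m) :=
    ((summable_nat_add_iff m).2 hcs).sum_le_tsum _ fun i _ => hc _
  rw [Real.dist_eq, sub_zero, abs_of_nonneg (he _)]
  linarith [hbound k, hK k (by omega)]

lemma mannSeq_mem {E : Type*} [AddCommGroup E] [Module ℝ E] {α β : ℕ → ℝ}
    (hα : ∀ n, α n ∈ Set.Ico (0 : ℝ) 1) (hβ : ∀ n, β n ∈ Set.Ico (0 : ℝ) 1) {X : Set E}
    (hXc : Convex ℝ X) (h0 : (0 : E) ∈ X) {f : ℕ → E → E} (hf : ∀ n, MapsTo (f n) X X)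
    {x₀ : E} (hx₀ : x₀ ∈ X) (n : ℕ) : mannSeq α β f x₀ n ∈ X := by
  induction n with
  | zero => exact hx₀
  | succ n ih =>
    refine hXc.smul_mem_of_zero_mem h0 ?_ ⟨by linarith [(hβ n).2], by linarith [(hβ n).1]⟩
    exact hXc ih (hf n ih) (hα n).1 (by linarith [(hα n).2]) (by ring)

lemma norm_mannSeq_succ_sub_le {E : Type*} [SeminormedAddCommGroup E] [NormedSpace ℝ E]
    {α β : ℕ → ℝ} {X : Set E} {f g : ℕ → E → E} {x₀ y₀ : E} {n : ℕ} {c : ℝ}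
    (hα : α n ∈ Set.Ico (0 : ℝ) 1) (hβ : β n ∈ Set.Ico (0 : ℝ) 1) (hc : 0 ≤ c)
    (hg : LipschitzOnWith 1 (g n) X)
    (hx : mannSeq α β f x₀ n ∈ X) (hy : mannSeq α β g y₀ n ∈ X)
    (hfg : ‖f n (mannSeq α β f x₀ n) - g n (mannSeq α β f x₀ n)‖ ≤ c) :
    ‖mannSeq α β f x₀ (n + 1) - mannSeq α β g y₀ (n + 1)‖ ≤
      (1 - β n) * ‖mannSeq α β f x₀ n - mannSeq α β g y₀ n‖ + c := by
  simp only [mannSeq]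
  set x := mannSeq α β f x₀ n
  set y := mannSeq α β g y₀ n
  obtain ⟨hα0, hα1⟩ := hα
  obtain ⟨hβ0, hβ1⟩ := hβ
  have hgxy : ‖g n x - g n y‖ ≤ ‖x - y‖ := by
    simpa [dist_eq_norm] using hg.dist_le_mul x hx y hy
  have hfx : ‖f n x - g n y‖ ≤ ‖x - y‖ + c := by
    calc ‖f n x - g n y‖ = ‖(f n x - g n x) + (g n x - g n y)‖ := by rw [sub_add_sub_cancel]
      _ ≤ ‖f n x - g n x‖ + ‖g n x - g n y‖ := norm_add_le _ _
      _ ≤ ‖x - y‖ + c := by linarith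
  have hsplit : (1 - β n) • (α n • x + (1 - α n) • f n x) -
      (1 - β n) • (α n • y + (1 - α n) • g n y) =
      (1 - β n) • (α n • (x - y) + (1 - α n) • (f n x - g n y)) := by module
  have hcomb : ‖α n • (x - y) + (1 - α n) • (f n x - g n y)‖ ≤ ‖x - y‖ + c := by
    refine (norm_add_le _ _).trans ?_
    rw [norm_smul, norm_smul, Real.norm_of_nonneg hα0, Real.norm_of_nonneg (by linarith)]
    nlinarith [mul_le_mul_of_nonneg_left hfx (sub_nonneg.2 hα1.le), mul_nonneg hα0 hc]
  rw [hsplit, norm_smul, Real.norm_of_nonneg (by linarith)]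
  nlinarith [mul_le_mul_of_nonneg_left hcomb (sub_nonneg.2 hβ1.le), mul_nonneg hβ0 hc]

/-- dampened Mann iteration with probabilistic guarantees.  If
the random approximating functions `F i` deviate from `f` by at least `γ i`
only with probability at most `δ i`, where `Σ γ i < ∞` and `Σ δ i < ∞`, then
the dampened Mann iteration (driven by an exact Mann scheme, starting at `0`)
converges to the least fixpoint of `f` almost surely. -/
theorem almost_sure_convergence
    (α β : ℕ → ℝ) (hexact : ExactScheme α β)
    (d : ℕ) (X : Set (Fin d → ℝ)) (hX : IsClosed X) (hXc : Convex ℝ X)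
    (hpos : ∀ x ∈ X, ∀ i, 0 ≤ x i) (h0 : (0 : Fin d → ℝ) ∈ X)
    (f : (Fin d → ℝ) → (Fin d → ℝ)) (hmap : Set.MapsTo f X X)
    (hmono : ∀ x ∈ X, ∀ y ∈ X, x ≤ y → f x ≤ f y)
    (hne : LipschitzOnWith 1 f X)
    (hfix : ∃ x ∈ X, f x = x)
    (μ : Fin d → ℝ) (hμ : IsLeast {x | x ∈ X ∧ f x = x} μ)
    (Ω : Type) [MeasurableSpace Ω] (P : Measure Ω) [IsProbabilityMeasure P]
    (F : ℕ → Ω → (Fin d → ℝ) → (Fin d → ℝ))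
    (hFmap : ∀ i ω, Set.MapsTo (F i ω) X X)
    (hFmono : ∀ i ω, ∀ x ∈ X, ∀ y ∈ X, x ≤ y → F i ω x ≤ F i ω y)
    (hFne : ∀ i ω, LipschitzOnWith 1 (F i ω) X)
    (γ δ : ℕ → ℝ) (hγ : ∀ i, 0 ≤ γ i) (hδ : ∀ i, 0 ≤ δ i)
    (hγs : Summable γ) (hδs : Summable δ)
    (hmeas : ∀ i, MeasurableSet {ω : Ω | ∃ x ∈ X, γ i ≤ ‖F i ω x - f x‖})
    (hprob : ∀ i, P {ω : Ω | ∃ x ∈ X, γ i ≤ ‖F i ω x - f x‖} ≤ ENNReal.ofReal (δ i)) :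
    ∀ᵐ ω ∂P, Tendsto (mannSeq α β (fun i => F i ω) 0) atTop (nhds μ) := by
  obtain ⟨hα, hβ, -, hβs, hconv⟩ := hexact
  have hlim := hconv d X hX hXc hpos h0 f hmap hmono hne hfix μ hμ 0 h0
  have hsum : ∑' i, P {ω : Ω | ∃ x ∈ X, γ i ≤ ‖F i ω x - f x‖} ≠ ⊤ :=
    ne_top_of_le_ne_top hδs.tsum_ofReal_ne_top (ENNReal.tsum_le_tsum hprob)
  filter_upwards [ae_eventually_notMem hsum] with ω hω
  have hdiff := tendsto_zero_of_eventually_le_one_sub_mul_add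
    (e := fun n => ‖mannSeq α β (fun i => F i ω) 0 n - mannSeq α β (fun _ => f) 0 n‖)
    (fun n => norm_nonneg _) hβ hβs hγ hγs <| hω.mono fun n hn => by
      have hx := mannSeq_mem hα hβ hXc h0 (fun i => hFmap i ω) h0 n
      refine norm_mannSeq_succ_sub_le (hα n) (hβ n) (hγ n) hne hx
        (mannSeq_mem hα hβ hXc h0 (fun _ => hmap) h0 n) ?_
      by_contra! hlt
      exact hn ⟨_, hx, hlt.le⟩
  simpa using (tendsto_zero_iff_norm_tendsto_zero.2 hdiff).add hlim
end
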